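/- Let G be a subgraph of a fullerene graph. If G contains the pentagonal ring R_5 as a subgraph, then G is not extremal. -/

import Mathlib

namespace FG

/-- A combinatorial plane (spherically embedded) graph: a finite simple graph together with
its collection of faces, each face recorded as the finset of edges of its boundary cycle.
Every face boundary is a cycle, every edge lies on exactly two faces, and Euler's formula
holds (edges are counted via the face incidences). -/
structure PlaneGraph (V : Type) [Fintype V] [DecidableEq V] : Type where
  graph : SimpleGraph V
  faces : Finset (Finset (Sym2 V))
  face_edges : ∀ f ∈ faces, ∀ e ∈ f, e ∈ graph.edgeSet
  face_cycle : ∀ f ∈ faces, ∃ (v : V) (c : graph.Walk v v), c.IsCycle ∧ c.edges.toFinset = f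
  edge_faces : ∀ e ∈ graph.edgeSet, (faces.filter (fun f => e ∈ f)).card = 2
  euler : 2 * (Fintype.card V + faces.card) = (∑ f ∈ faces, f.card) + 4

variable {V : Type} [Fintype V] [DecidableEq V]

/-- The vertices incident with at least one edge of an edge set. -/
def edgeVerts (E : Finset (Sym2 V)) : Finset V :=
  Finset.univ.filter fun v => ∃ e ∈ E, v ∈ e

/-- The degree of a vertex in the subgraph spanned by an edge set. -/
def deg (E : Finset (Sym2 V)) (v : V) : ℕ := (E.filter fun e => v ∈ e).card

/-- The vertices covered by a collection of faces. -/
def facesVerts (H : Finset (Finset (Sym2 V))) : Finset V := edgeVerts (H.sup id)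

/-- An edge set is a matching: non-loop edges, pairwise vertex-disjoint. -/
def IsMatching (M : Finset (Sym2 V)) : Prop :=
  (∀ e ∈ M, ¬e.IsDiag) ∧ ∀ e ∈ M, ∀ e' ∈ M, e ≠ e' → ∀ v : V, v ∈ e → v ∉ e'

/-- A fullerene graph: a cubic 3-connected plane graph with (exactly 12) pentagonal
faces and hexagonal faces. -/
structure IsFullerene (P : PlaneGraph V) : Prop where
  cubic : ∀ v : V, (P.graph.neighborSet v).ncard = 3
  threeConnected : ∀ s : Set V, s.ncard ≤ 2 → (SimpleGraph.induce sᶜ P.graph).Connected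
  faceSize : ∀ f ∈ P.faces, f.card = 5 ∨ f.card = 6
  pentTwelve : (P.faces.filter fun f => f.card = 5).card = 12

/-- A fragment of a plane graph: a nonempty set of faces (a cycle together with its
interior) whose boundary — the set of edges lying on exactly one chosen face — is a
single cycle. -/
structure Fragment (P : PlaneGraph V) : Type where
  inFaces : Finset (Finset (Sym2 V))
  nonempty : inFaces.Nonempty
  subFaces : inFaces ⊆ P.faces
  boundary_cycle : ∃ (v : V) (c : P.graph.Walk v v), c.IsCycle ∧
    c.edges.toFinset =
      (inFaces.sup id).filter fun e => (inFaces.filter fun f => e ∈ f).card = 1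

/-- The edge set of a fragment. -/
def Fragment.edges {P : PlaneGraph V} (B : Fragment P) : Finset (Sym2 V) := B.inFaces.sup id

/-- The boundary edges of a fragment. -/
def Fragment.boundary {P : PlaneGraph V} (B : Fragment P) : Finset (Sym2 V) :=
  B.edges.filter fun e => (B.inFaces.filter fun f => e ∈ f).card = 1

/-- A pentagonal fragment: all inner faces are pentagons. -/
def IsPentagonalFragment {P : PlaneGraph V} (B : Fragment P) : Prop :=
  ∀ f ∈ B.inFaces, f.card = 5

/-- The faces of `P` adjoining the subgraph with edge set `E`: not a face of the
subgraph, but sharing at least one edge with it. -/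
def adjoiningFaces (P : PlaneGraph V) (E : Finset (Sym2 V)) : Finset (Finset (Sym2 V)) :=
  P.faces.filter fun f => ¬f ⊆ E ∧ (f ∩ E).Nonempty

/-- The territory `T[G]` of the subgraph with edge set `E`: the subgraph together with
all adjoining faces. -/
def territoryEdges (P : PlaneGraph V) (E : Finset (Sym2 V)) : Finset (Sym2 V) :=
  E ∪ (adjoiningFaces P E).sup id

/-- `w(G)`: the number of 2-degree vertices of the subgraph spanned by `E`. -/
def wcount (E : Finset (Sym2 V)) : ℕ := ((edgeVerts E).filter fun v => deg E v = 2).card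

/-- A subgraph is maximal in `P` when its hexagon extension is contained in `P`,
i.e. every adjoining face is a hexagon. -/
def IsMaximalIn (P : PlaneGraph V) (E : Finset (Sym2 V)) : Prop :=
  ∀ f ∈ adjoiningFaces P E, f.card = 6

/-- `H ∈ 𝒮(G)` for the subgraph `G` with edge set `E`: `H` is a set of mutually disjoint
hexagons of the hexagon extension `H[G]` (hexagonal faces sharing at least one edge with
`G`) such that `G − H` has a matching covering all remaining 3-degree vertices of `G`. -/
def SextetAdm (P : PlaneGraph V) (E : Finset (Sym2 V)) (H : Finset (Finset (Sym2 V))) : Prop :=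
  (∀ f ∈ H, f ∈ P.faces ∧ f.card = 6 ∧ (f ∩ E).Nonempty) ∧
  (∀ f ∈ H, ∀ g ∈ H, f ≠ g → Disjoint (edgeVerts f) (edgeVerts g)) ∧
  ∃ M : Finset (Sym2 V), M ⊆ E ∧ IsMatching M ∧
    (∀ e ∈ M, ∀ v : V, v ∈ e → v ∉ facesVerts H) ∧
    ∀ v ∈ edgeVerts E, deg E v = 3 → v ∉ facesVerts H → ∃ e ∈ M, v ∈ e

/-- `U_H(G) = V(G) ∖ V(H)`. -/
def Uset (E : Finset (Sym2 V)) (H : Finset (Finset (Sym2 V))) : Finset V :=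
  edgeVerts E \ facesVerts H

/-- A Clar set of `H[G]`: a member of `𝒮(G)` minimizing `|U_H(G)|`. -/
def IsClarSet (P : PlaneGraph V) (E : Finset (Sym2 V)) (H : Finset (Finset (Sym2 V))) : Prop :=
  SextetAdm P E H ∧ ∀ H', SextetAdm P E H' → (Uset E H).card ≤ (Uset E H').card

/-- A normal Clar set: a Clar set such that `G − H` has a perfect matching. -/
def IsNormalClarSet (P : PlaneGraph V) (E : Finset (Sym2 V))
    (H : Finset (Finset (Sym2 V))) : Prop :=
  IsClarSet P E H ∧ ∃ M : Finset (Sym2 V), M ⊆ E ∧ IsMatching M ∧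
    (∀ e ∈ M, ∀ v : V, v ∈ e → v ∉ facesVerts H) ∧
    ∀ v ∈ Uset E H, ∃ e ∈ M, v ∈ e

/-- The pentagonal faces of the subgraph with edge set `E`. -/
def pentFaces (P : PlaneGraph V) (E : Finset (Sym2 V)) : Finset (Finset (Sym2 V)) :=
  P.faces.filter fun f => f.card = 5 ∧ f ⊆ E

/-- A subgraph with `k` pentagons is extremal if `|U_H(G)| = k` for a Clar set `H`. -/
def IsExtremalSub (P : PlaneGraph V) (E : Finset (Sym2 V)) : Prop :=
  ∃ H, IsClarSet P E H ∧ (Uset E H).card = (pentFaces P E).card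

/-- A pentagonal ring `R_k`: `k` pentagonal faces `R 0, …, R (k-1)` such that
`R i` and `R j` intersect iff `|i − j| = 1 (mod k)`. -/
def IsPentRing (P : PlaneGraph V) (k : ℕ) (R : ZMod k → Finset (Sym2 V)) : Prop :=
  Function.Injective R ∧ (∀ i, R i ∈ P.faces ∧ (R i).card = 5) ∧
  ∀ i j : ZMod k, i ≠ j →
    ((edgeVerts (R i) ∩ edgeVerts (R j)).Nonempty ↔ (j = i + 1 ∨ i = j + 1))

/-- The number of pentagons of the pentagonal fragment `B` adjoining (sharing an edge
with) the pentagon `p`. -/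
def pentAdjCount {P : PlaneGraph V} (B : Fragment P) (p : Finset (Sym2 V)) : ℕ :=
  (B.inFaces.filter fun q => q ≠ p ∧ (q ∩ p).Nonempty).card

/-- The fragment consisting of a single pentagon `P`. -/
def IsPentagonFrag {P : PlaneGraph V} (B : Fragment P) : Prop :=
  IsPentagonalFragment B ∧ B.inFaces.card = 1

/-- `B_2`: the extremal pentagonal fragment with 4 pentagons whose Clar extension is
normal. -/
def IsB2Frag {P : PlaneGraph V} (B : Fragment P) : Prop :=
  IsPentagonalFragment B ∧ B.inFaces.card = 4 ∧ IsExtremalSub P B.edges ∧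
    ∃ H, IsNormalClarSet P B.edges H

/-- `B_3`: the extremal pentagonal fragment with 6 pentagons whose Clar extension is
normal. -/
def IsB3Frag {P : PlaneGraph V} (B : Fragment P) : Prop :=
  IsPentagonalFragment B ∧ B.inFaces.card = 6 ∧ IsExtremalSub P B.edges ∧
    ∃ H, IsNormalClarSet P B.edges H

/-- A pasting edge of the subgraph with edge set `E`: an edge of `E` lying on the
boundary of the Clar extension `C[G]` (not an edge of a Clar hexagon) whose two
end-vertices belong to `V(H)` for a Clar set `H`. -/
def IsPastingEdge (P : PlaneGraph V) (E : Finset (Sym2 V)) (e : Sym2 V) : Prop :=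
  e ∈ E ∧ ∃ H, IsClarSet P E H ∧ (∀ v : V, v ∈ e → v ∈ facesVerts H) ∧ e ∉ H.sup id

/-- `B` arises from pasting `A` and `C` along a common pasting edge:
`B = A ∪ C` and `A ∩ C` is a single pasting edge of both. -/
def IsPasting {P : PlaneGraph V} (B A C : Fragment P) : Prop :=
  B.inFaces = A.inFaces ∪ C.inFaces ∧
  ∃ e : Sym2 V, A.edges ∩ C.edges = {e} ∧ IsPastingEdge P A.edges e ∧ IsPastingEdge P C.edges e

def IsBasicFrag {P : PlaneGraph V} (B : Fragment P) : Prop :=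
  IsPentagonFrag B ∨ IsB2Frag B ∨ IsB3Frag B

/-- The pentagonal fragments generated from `P`, `B_2`, `B_3` by the pasting operation. -/
inductive Pasted (P : PlaneGraph V) : Fragment P → Prop
  | base (B : Fragment P) : IsBasicFrag B → Pasted P B
  | paste (B A C : Fragment P) : Pasted P A → IsBasicFrag C → IsPasting B A C → Pasted P B

/-- `P ∗ P`. -/
def IsPPFrag {P : PlaneGraph V} (B : Fragment P) : Prop :=
  ∃ A C : Fragment P, IsPentagonFrag A ∧ IsPentagonFrag C ∧ IsPasting B A C

/-- `P ∗ B_2`. -/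
def IsPB2Frag {P : PlaneGraph V} (B : Fragment P) : Prop :=
  ∃ A C : Fragment P, IsPentagonFrag A ∧ IsB2Frag C ∧ IsPasting B A C

/-- `P ∗ B_2 ∗ P`. -/
def IsPB2PFrag {P : PlaneGraph V} (B : Fragment P) : Prop :=
  ∃ B' A C D : Fragment P, IsPentagonFrag A ∧ IsB2Frag C ∧ IsPentagonFrag D ∧
    IsPasting B' A C ∧ IsPasting B B' D

/-- The six members of `𝓑_{≥60}`. -/
def SixShapes {P : PlaneGraph V} (B : Fragment P) : Prop :=
  IsPentagonFrag B ∨ IsB2Frag B ∨ IsB3Frag B ∨ IsPPFrag B ∨ IsPB2Frag B ∨ IsPB2PFrag B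

/-- `B_1`: two vertex-disjoint pentagons joined by an edge. -/
def IsB1 (P : PlaneGraph V) (E : Finset (Sym2 V)) : Prop :=
  ∃ (f g : Finset (Sym2 V)) (a b : V), f ∈ P.faces ∧ g ∈ P.faces ∧ f.card = 5 ∧ g.card = 5 ∧
    Disjoint (edgeVerts f) (edgeVerts g) ∧ P.graph.Adj a b ∧
    a ∈ edgeVerts f ∧ b ∈ edgeVerts g ∧ E = f ∪ g ∪ {s(a, b)}

/-- `B_1^k`: `k` copies of `B_1` pasted together along pasting edges of their pentagons. -/
inductive B1Pow (P : PlaneGraph V) : ℕ → Finset (Sym2 V) → Prop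
  | one (E : Finset (Sym2 V)) : IsB1 P E → B1Pow P 1 E
  | succ (k : ℕ) (E X : Finset (Sym2 V)) (e : Sym2 V) (f g : Finset (Sym2 V)) :
      B1Pow P k E → IsB1 P X → E ∩ X = {e} → f ∈ P.faces → g ∈ P.faces →
      f.card = 5 → g.card = 5 → f ⊆ E → g ⊆ X → e ∈ f → e ∈ g →
      IsPastingEdge P f e → IsPastingEdge P g e → B1Pow P (k + 1) (E ∪ X)

/-- `F` contains `B_1^k` for some `2 ≤ k ≤ 4` as a subgraph. -/
def ContainsB1Pow (P : PlaneGraph V) : Prop :=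
  ∃ (k : ℕ) (E : Finset (Sym2 V)), 2 ≤ k ∧ k ≤ 4 ∧ B1Pow P k E

/-- A perfect matching of the plane graph `P`. -/
def IsPerfectMatching (P : PlaneGraph V) (M : Finset (Sym2 V)) : Prop :=
  (∀ e ∈ M, e ∈ P.graph.edgeSet) ∧ IsMatching M ∧ ∀ v : V, ∃ e ∈ M, v ∈ e

/-- A sextet pattern of `P`: mutually disjoint hexagonal faces, all alternating with
respect to a common perfect matching. -/
def IsSextetPattern (P : PlaneGraph V) (H : Finset (Finset (Sym2 V))) : Prop :=
  (∀ f ∈ H, f ∈ P.faces ∧ f.card = 6) ∧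
  (∀ f ∈ H, ∀ g ∈ H, f ≠ g → Disjoint (edgeVerts f) (edgeVerts g)) ∧
  ∃ M : Finset (Sym2 V), IsPerfectMatching P M ∧ ∀ f ∈ H, (f ∩ M).card = 3

/-- A Clar formula: a maximum sextet pattern. -/
def IsClarFormula (P : PlaneGraph V) (H : Finset (Finset (Sym2 V))) : Prop :=
  IsSextetPattern P H ∧ ∀ H', IsSextetPattern P H' → H'.card ≤ H.card

/-- An extremal fullerene graph: the Clar number equals `(n − 12)/6`. -/
def IsExtremalFullerene (P : PlaneGraph V) : Prop :=
  ∃ H, IsClarFormula P H ∧ 6 * H.card = Fintype.card V - 12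

/-- The edges of the union of all maximal pentagonal fragments of `P`. -/
noncomputable def maxPentEdges (P : PlaneGraph V) : Finset (Sym2 V) :=
  @Finset.filter _
    (fun e => ∃ B : Fragment P, IsPentagonalFragment B ∧ IsMaximalIn P B.edges ∧ e ∈ B.edges)
    (Classical.decPred _) (P.faces.sup id)

/-- The disjoint union of two copies of `K_2`. -/
def twoK2 : SimpleGraph (Fin 4) := SimpleGraph.fromEdgeSet {s(0, 1), s(2, 3)}

/-- The tree `T_0` on six vertices: two adjacent 3-degree vertices, each also adjacent
to two leaves. -/
def treeT0 : SimpleGraph (Fin 6) :=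
  SimpleGraph.fromEdgeSet {s(0, 1), s(0, 2), s(0, 3), s(1, 4), s(1, 5)}


section

set_option linter.unusedSectionVars false

open Finset

theorem mem_edgeVerts {E : Finset (Sym2 V)} {v : V} :
    v ∈ edgeVerts E ↔ ∃ e ∈ E, v ∈ e := by
  simp [edgeVerts]

theorem card_filter_mem_edge {e : Sym2 V} (he : ¬ e.IsDiag) :
    (univ.filter fun v : V => v ∈ e).card = 2 := by
  induction e using Sym2.ind with
  | _ a b =>
    have hab : a ≠ b := by simpa using he
    have : (univ.filter fun v : V => v ∈ s(a, b)) = {a, b} := by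
      ext v; simp
    rw [this, card_pair hab]

theorem handshake (N : Finset (Sym2 V)) (hN : ∀ e ∈ N, ¬ e.IsDiag) :
    ∑ v ∈ edgeVerts N, (N.filter fun e => v ∈ e).card = 2 * N.card := by
  have h := Finset.sum_card_bipartiteAbove_eq_sum_card_bipartiteBelow
    (s := edgeVerts N) (t := N) (fun (v : V) (e : Sym2 V) => v ∈ e)
  simp only [bipartiteAbove, bipartiteBelow] at h
  rw [h, mul_comm, ← smul_eq_mul, ← Finset.sum_const]
  refine Finset.sum_congr rfl fun e he => ?_
  rw [← card_filter_mem_edge (hN e he)]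
  congr 1
  ext v
  simp only [mem_filter, mem_univ, true_and, mem_edgeVerts]
  exact ⟨fun h => h.2, fun h => ⟨⟨e, he, h⟩, h⟩⟩

theorem matching_card (N : Finset (Sym2 V)) (hN : IsMatching N) :
    (edgeVerts N).card = 2 * N.card := by
  rw [← handshake N hN.1, card_eq_sum_ones]
  refine Finset.sum_congr rfl fun v hv => ?_
  symm
  rw [card_eq_one]
  obtain ⟨e, he, hve⟩ := mem_edgeVerts.1 hv
  refine ⟨e, ?_⟩
  ext e'
  simp only [mem_filter, mem_singleton]
  constructor
  · rintro ⟨h1, h2⟩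
    by_contra hne
    exact hN.2 e' h1 e he hne v h2 hve
  · rintro rfl
    exact ⟨he, hve⟩

theorem card_image_mk (s : Set V) (v : V) : ((fun w => s(v, w)) '' s).ncard = s.ncard := by
  apply Set.ncard_image_of_injective
  intro a b h
  exact Sym2.congr_right.1 h

theorem face_not_diag (P : PlaneGraph V) {f : Finset (Sym2 V)} (hf : f ∈ P.faces)
    {e : Sym2 V} (he : e ∈ f) : ¬ e.IsDiag :=
  P.graph.not_isDiag_of_mem_edgeSet (P.face_edges f hf e he)

theorem face_deg (P : PlaneGraph V) {f : Finset (Sym2 V)} (hf : f ∈ P.faces) {v : V}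
    (hv : v ∈ edgeVerts f) : (f.filter fun e => v ∈ e).card = 2 := by
  obtain ⟨u, c, hc, rfl⟩ := P.face_cycle f hf
  obtain ⟨e, he, hve⟩ := mem_edgeVerts.1 hv
  have hvs : v ∈ c.support := by
    induction e using Sym2.ind with
    | _ a b =>
      have he' : s(a, b) ∈ c.edges := by simpa using he
      rcases Sym2.mem_iff.1 hve with rfl | rfl
      · exact c.fst_mem_support_of_mem_edges he'
      · exact c.snd_mem_support_of_mem_edges he'
  have h2 := hc.ncard_neighborSet_toSubgraph_eq_two hvs
  rw [← card_image_mk _ v] at h2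
  rw [← h2, ← Set.ncard_coe_finset]
  congr 1
  ext e
  simp only [coe_filter, List.mem_toFinset, Set.mem_ofPred_eq, Set.mem_image,
    SimpleGraph.Subgraph.mem_neighborSet]
  constructor
  · rintro ⟨h, hv⟩
    obtain ⟨w, rfl⟩ := Sym2.mem_iff_exists.1 hv
    exact ⟨w, by rwa [← SimpleGraph.Subgraph.mem_edgeSet, SimpleGraph.Walk.mem_edges_toSubgraph], rfl⟩
  · rintro ⟨w, h, rfl⟩
    rw [← SimpleGraph.Subgraph.mem_edgeSet, SimpleGraph.Walk.mem_edges_toSubgraph] at h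
    exact ⟨h, by simp⟩

theorem face_verts_card (P : PlaneGraph V) {f : Finset (Sym2 V)} (hf : f ∈ P.faces) :
    (edgeVerts f).card = f.card := by
  have h := handshake f (fun e he => face_not_diag P hf he)
  rw [Finset.sum_congr rfl (fun v hv => face_deg P hf hv)] at h
  simp at h
  omega

open Classical in
/-- all graph edges -/
noncomputable def allE (P : PlaneGraph V) : Finset (Sym2 V) :=
  univ.filter fun e => e ∈ P.graph.edgeSet

theorem mem_allE {P : PlaneGraph V} {e : Sym2 V} : e ∈ allE P ↔ e ∈ P.graph.edgeSet := by
  simp [allE]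

theorem deg_allE (P : PlaneGraph V) (hP : IsFullerene P) (v : V) :
    ((allE P).filter fun e => v ∈ e).card = 3 := by
  rw [← hP.cubic v, ← card_image_mk _ v, ← Set.ncard_coe_finset]
  congr 1
  ext e
  simp only [coe_filter, mem_allE, Set.mem_ofPred_eq, Set.mem_image,
    SimpleGraph.mem_neighborSet]
  constructor
  · rintro ⟨h, hv⟩
    obtain ⟨w, rfl⟩ := Sym2.mem_iff_exists.1 hv
    exact ⟨w, h, rfl⟩
  · rintro ⟨w, h, rfl⟩
    exact ⟨h, by simp⟩

theorem face_filter_sub (P : PlaneGraph V) {f : Finset (Sym2 V)} (hf : f ∈ P.faces) (v : V) :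
    (f.filter fun e => v ∈ e) ⊆ (allE P).filter fun e => v ∈ e := by
  intro e he
  rw [mem_filter] at he ⊢
  exact ⟨mem_allE.2 (P.face_edges f hf e he.1), he.2⟩

/-- an edge lies on no three faces -/
theorem three_faces (P : PlaneGraph V) {f g h : Finset (Sym2 V)} (hf : f ∈ P.faces)
    (hg : g ∈ P.faces) (hh : h ∈ P.faces) {e : Sym2 V} (ef : e ∈ f) (eg : e ∈ g) (eh : e ∈ h)
    (h1 : f ≠ g) : h = f ∨ h = g := by
  by_contra hcon
  push Not at hcon
  have h2 := P.edge_faces e (P.face_edges f hf e ef)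
  have h3 : ({f, g, h} : Finset _) ⊆ P.faces.filter (fun f => e ∈ f) := by
    intro x hx
    simp only [mem_insert, mem_singleton] at hx
    rcases hx with rfl | rfl | rfl <;> simp [*]
  have h4 := card_le_card h3
  rw [card_eq_three.2 ⟨f, g, h, h1, hcon.1.symm, hcon.2.symm, rfl⟩] at h4
  omega

/-- two distinct faces at a vertex: at most one common edge -/
theorem common_le (P : PlaneGraph V) (hP : IsFullerene P) {f g : Finset (Sym2 V)}
    (hf : f ∈ P.faces) (hg : g ∈ P.faces) (hfg : f ≠ g) {v : V}
    {a b : Sym2 V} (haf : a ∈ f) (hag : a ∈ g) (hbf : b ∈ f) (hbg : b ∈ g)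
    (hva : v ∈ a) (hvb : v ∈ b) : a = b := by
  by_contra hab
  have hvf : v ∈ edgeVerts f := mem_edgeVerts.2 ⟨a, haf, hva⟩
  have hvg : v ∈ edgeVerts g := mem_edgeVerts.2 ⟨a, hag, hva⟩
  have key : ∀ h ∈ P.faces, v ∈ edgeVerts h → a ∈ h → b ∈ h →
      (h.filter fun e => v ∈ e) = {a, b} := by
    intro h hh hv ha hb
    symm
    apply eq_of_subset_of_card_le
    · intro x hx
      simp only [mem_insert, mem_singleton] at hx
      rcases hx with rfl | rfl <;> simp [*]
    · rw [face_deg P hh hv, card_pair hab]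
  have kf := key f hf hvf haf hbf
  have kg := key g hg hvg hag hbg
  -- third edge
  have h3 := deg_allE P hP v
  obtain ⟨k, hk, hkab⟩ : ∃ k ∈ ((allE P).filter fun e => v ∈ e), k ∉ ({a, b} : Finset _) := by
    apply exists_mem_notMem_of_card_lt_card
    rw [h3, card_pair hab]; omega
  rw [mem_filter, mem_allE] at hk
  have hk2 := P.edge_faces k hk.1
  obtain ⟨f', hf'⟩ : (P.faces.filter (fun f => k ∈ f)).Nonempty := by
    rw [← card_pos]; omega
  rw [mem_filter] at hf'
  have hkf : k ∉ f := fun h => hkab (by rw [← kf]; simp [h, hk.2])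
  have hkg : k ∉ g := fun h => hkab (by rw [← kg]; simp [h, hk.2])
  have hvf' : v ∈ edgeVerts f' := mem_edgeVerts.2 ⟨k, hf'.2, hk.2⟩
  have hd := face_deg P hf'.1 hvf'
  obtain ⟨m, hm, hmk⟩ : ∃ m ∈ (f'.filter fun e => v ∈ e), m ∉ ({k} : Finset _) := by
    apply exists_mem_notMem_of_card_lt_card
    rw [hd]; simp
  have hall : ((allE P).filter fun e => v ∈ e) = {a, b, k} := by
    symm
    apply eq_of_subset_of_card_le
    · intro x hx
      simp only [mem_insert, mem_singleton] at hx
      rcases hx with rfl | rfl | rfl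
      · simp [mem_allE, hva, P.face_edges f hf _ haf]
      · simp [mem_allE, hvb, P.face_edges f hf _ hbf]
      · simp [mem_allE, hk.1, hk.2]
    · rw [h3]
      rw [card_eq_three.2 ⟨a, b, k, hab, ?_, ?_, rfl⟩]
      · rintro rfl; simp at hkab
      · rintro rfl; simp at hkab
  have hm' := face_filter_sub P hf'.1 v hm
  rw [hall] at hm'
  rw [mem_filter] at hm
  have hne1 : f' ≠ f := by rintro rfl; exact hkf hf'.2
  have hne2 : f' ≠ g := by rintro rfl; exact hkg hf'.2
  simp only [mem_insert, mem_singleton] at hm' hmk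
  rcases hm' with rfl | rfl | rfl
  · rcases three_faces P hf hg hf'.1 haf hag hm.1 hfg with h | h <;> contradiction
  · rcases three_faces P hf hg hf'.1 hbf hbg hm.1 hfg with h | h <;> contradiction
  · exact hmk rfl

/-- two distinct faces at a vertex cover all edges there -/
theorem cover_edges (P : PlaneGraph V) (hP : IsFullerene P) {f g : Finset (Sym2 V)}
    (hf : f ∈ P.faces) (hg : g ∈ P.faces) (hfg : f ≠ g) {v : V}
    (hvf : v ∈ edgeVerts f) (hvg : v ∈ edgeVerts g) :
    (∀ e ∈ P.graph.edgeSet, v ∈ e → e ∈ f ∨ e ∈ g) ∧ ∃ e ∈ f, e ∈ g ∧ v ∈ e := by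
  have h1 := face_deg P hf hvf
  have h2 := face_deg P hg hvg
  have h3 := deg_allE P hP v
  have hsub := union_subset (face_filter_sub P hf v) (face_filter_sub P hg v)
  have hui := card_union_add_card_inter (f.filter fun e => v ∈ e) (g.filter fun e => v ∈ e)
  have hile : ((f.filter fun e => v ∈ e) ∩ (g.filter fun e => v ∈ e)).card ≤ 1 := by
    rw [card_le_one]
    intro a ha b hb
    simp only [mem_inter, mem_filter] at ha hb
    exact common_le P hP hf hg hfg ha.1.1 ha.2.1 hb.1.1 hb.2.1 ha.1.2 hb.1.2
  have hle := card_le_card hsub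
  constructor
  · have heq := eq_of_subset_of_card_le hsub (by omega)
    intro e he hv
    have : e ∈ (allE P).filter fun e => v ∈ e := by simp [mem_allE, he, hv]
    rw [← heq] at this
    simp only [mem_union, mem_filter] at this
    tauto
  · obtain ⟨e, he⟩ : ((f.filter fun e => v ∈ e) ∩ (g.filter fun e => v ∈ e)).Nonempty := by
      rw [← card_pos]; omega
    simp only [mem_inter, mem_filter] at he
    exact ⟨e, he.1.1, he.2.1, he.1.2⟩

/-- exactly three faces at a vertex -/
theorem faces_at (P : PlaneGraph V) (hP : IsFullerene P) (v : V) :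
    (P.faces.filter fun f => v ∈ edgeVerts f).card = 3 := by
  have h := Finset.sum_card_bipartiteAbove_eq_sum_card_bipartiteBelow
    (s := P.faces.filter fun f => v ∈ edgeVerts f) (t := (allE P).filter fun e => v ∈ e)
    (fun (f : Finset (Sym2 V)) (e : Sym2 V) => e ∈ f)
  simp only [bipartiteAbove, bipartiteBelow] at h
  rw [Finset.sum_congr rfl (g := fun _ => 2), Finset.sum_congr (s₂ := (allE P).filter fun e => v ∈ e)
    rfl (g := fun _ => 2)] at h
  · simp only [sum_const, smul_eq_mul, deg_allE P hP v] at h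
    omega
  · intro e he
    rw [mem_filter, mem_allE] at he
    rw [← P.edge_faces e he.1]
    congr 1
    ext f
    simp only [mem_filter, mem_edgeVerts]
    exact ⟨fun h => ⟨h.1.1, h.2⟩, fun h => ⟨⟨h.1, e, h.2, he.2⟩, h.2⟩⟩
  · intro f hf
    rw [mem_filter] at hf
    rw [← face_deg P hf.1 hf.2]
    congr 1
    ext e
    simp only [mem_filter, mem_allE]
    exact ⟨fun h => ⟨h.2, h.1.2⟩, fun h => ⟨⟨P.face_edges f hf.1 e h.1, h.2⟩, h.1⟩⟩

/-- common vertices of two distinct faces are matched by common edges -/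
theorem inter_matching (P : PlaneGraph V) (hP : IsFullerene P) {f g : Finset (Sym2 V)}
    (hf : f ∈ P.faces) (hg : g ∈ P.faces) (hfg : f ≠ g) :
    edgeVerts f ∩ edgeVerts g = edgeVerts (f ∩ g) ∧
      (edgeVerts f ∩ edgeVerts g).card = 2 * (f ∩ g).card := by
  have h1 : edgeVerts f ∩ edgeVerts g = edgeVerts (f ∩ g) := by
    ext v
    rw [mem_inter]
    constructor
    · rintro ⟨h1, h2⟩
      obtain ⟨e, h3, h4, h5⟩ := (cover_edges P hP hf hg hfg h1 h2).2
      exact mem_edgeVerts.2 ⟨e, mem_inter.2 ⟨h3, h4⟩, h5⟩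
    · intro h
      obtain ⟨e, he, hv⟩ := mem_edgeVerts.1 h
      rw [mem_inter] at he
      exact ⟨mem_edgeVerts.2 ⟨e, he.1, hv⟩, mem_edgeVerts.2 ⟨e, he.2, hv⟩⟩
  refine ⟨h1, ?_⟩
  rw [h1]
  apply matching_card
  constructor
  · intro e he
    exact face_not_diag P hf (mem_inter.1 he).1
  · intro e he e' he' hne v hv hv'
    rw [mem_inter] at he he'
    exact hne (common_le P hP hf hg hfg he.1 he.2 he'.1 he'.2 hv hv')

theorem graph_connected (P : PlaneGraph V) (hP : IsFullerene P) : P.graph.Connected := by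
  have h := hP.threeConnected ∅ (by simp)
  rw [Set.compl_empty] at h
  exact (SimpleGraph.induceUnivIso P.graph).connected_iff.1 h

/-- sum of values at the two ends of an edge -/
def endSum (x : V → ZMod 2) (e : Sym2 V) : ZMod 2 :=
  Sym2.lift ⟨fun a b => x a + x b, fun a b => add_comm _ _⟩ e

@[simp] theorem endSum_mk (x : V → ZMod 2) (a b : V) : endSum x s(a, b) = x a + x b := rfl

theorem walk_sum {G : SimpleGraph V} (x : V → ZMod 2) {u v : V} (p : G.Walk u v) :
    (p.edges.map (endSum x)).sum = x u + x v := by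
  induction p with
  | nil => simp [CharTwo.add_self_eq_zero]
  | @cons a b c h p ih =>
    simp only [SimpleGraph.Walk.edges_cons, List.map_cons, List.sum_cons, endSum_mk, ih]
    have := CharTwo.add_self_eq_zero (x b)
    linear_combination this

theorem face_sum (P : PlaneGraph V) (x : V → ZMod 2) {f : Finset (Sym2 V)} (hf : f ∈ P.faces) :
    ∑ e ∈ f, endSum x e = 0 := by
  obtain ⟨u, c, hc, rfl⟩ := P.face_cycle f hf
  rw [List.sum_toFinset _ hc.1.1.edges_nodup, walk_sum, CharTwo.add_self_eq_zero]

theorem two_card_allE (P : PlaneGraph V) : ∑ f ∈ P.faces, f.card = 2 * (allE P).card := by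
  have h := Finset.sum_card_bipartiteAbove_eq_sum_card_bipartiteBelow
    (s := P.faces) (t := allE P)
    (fun (f : Finset (Sym2 V)) (e : Sym2 V) => e ∈ f)
  simp only [bipartiteAbove, bipartiteBelow] at h
  rw [Finset.sum_congr rfl (g := fun f => f.card), Finset.sum_congr (s₂ := allE P)
    rfl (g := fun _ => 2)] at h
  · rw [h]; simp [mul_comm]
  · intro e he
    exact P.edge_faces e (mem_allE.1 he)
  · intro f hf
    congr 1
    ext e
    simp only [mem_filter, mem_allE]
    exact ⟨fun h => h.2, fun h => ⟨P.face_edges f hf e h, h⟩⟩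

theorem dual_const (P : PlaneGraph V) (hP : IsFullerene P) {α : Type} (y : Finset (Sym2 V) → α)
    (hy : ∀ f ∈ P.faces, ∀ g ∈ P.faces, ∀ e ∈ f, e ∈ g → y f = y g) :
    ∀ f ∈ P.faces, ∀ g ∈ P.faces, y f = y g := by
  have hv : ∀ v : V, ∀ f ∈ P.faces, ∀ g ∈ P.faces, v ∈ edgeVerts f → v ∈ edgeVerts g →
      y f = y g := by
    intro v f hf g hg h1 h2
    by_cases hfg : f = g
    · rw [hfg]
    · obtain ⟨e, h3, h4, _⟩ := (cover_edges P hP hf hg hfg h1 h2).2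
      exact hy f hf g hg e h3 h4
  have hw : ∀ u v : V, P.graph.Walk u v → ∀ f ∈ P.faces, ∀ g ∈ P.faces, u ∈ edgeVerts f →
      v ∈ edgeVerts g → y f = y g := by
    intro u v p
    induction p with
    | nil => exact hv _
    | @cons a b c h p ih =>
      intro f hf g hg h1 h2
      have h3 := P.edge_faces s(a, b) h
      obtain ⟨k, hk⟩ : (P.faces.filter (fun f => s(a, b) ∈ f)).Nonempty := by
        rw [← card_pos]; omega
      rw [mem_filter] at hk
      rw [hv a f hf k hk.1 h1 (mem_edgeVerts.2 ⟨_, hk.2, by simp⟩)]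
      exact ih k hk.1 g hg (mem_edgeVerts.2 ⟨_, hk.2, by simp⟩) h2
  have hne : ∀ f ∈ P.faces, ∃ v, v ∈ edgeVerts f := by
    intro f hf
    have := face_verts_card P hf
    have h5 := hP.faceSize f hf
    have : (edgeVerts f).Nonempty := by rw [← card_pos]; omega
    exact this
  intro f hf g hg
  obtain ⟨u, hu⟩ := hne f hf
  obtain ⟨v, hv⟩ := hne g hg
  obtain ⟨p⟩ := (graph_connected P hP).preconnected u v
  exact hw u v p f hf g hg hu hv

/-- the coboundary on vertices -/
noncomputable def cob (P : PlaneGraph V) : (V → ZMod 2) →ₗ[ZMod 2] (allE P → ZMod 2) where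
  toFun x e := endSum x e.1
  map_add' x y := by
    ext ⟨e, he⟩
    induction e using Sym2.ind with
    | _ a b => simp; ring
  map_smul' c x := by
    ext ⟨e, he⟩
    induction e using Sym2.ind with
    | _ a b => simp; ring

/-- face-edge incidence matrix -/
def incM (P : PlaneGraph V) : Matrix P.faces (allE P) (ZMod 2) :=
  fun f e => if e.1 ∈ f.1 then 1 else 0

theorem finrank_le_one_of_const {ι : Type} [Fintype ι] (W : Submodule (ZMod 2) (ι → ZMod 2))
    (h : ∀ x ∈ W, ∀ i j, x i = x j) : Module.finrank (ZMod 2) W ≤ 1 := by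
  have : W ≤ Submodule.span (ZMod 2) {fun _ => (1 : ZMod 2)} := by
    intro x hx
    rw [Submodule.mem_span_singleton]
    by_cases hne : Nonempty ι
    · obtain ⟨i⟩ := hne
      refine ⟨x i, ?_⟩
      ext j
      simp [h x hx i j]
    · refine ⟨0, ?_⟩
      ext j
      exact (hne ⟨j⟩).elim
  refine (Submodule.finrank_mono this).trans ?_
  exact (finrank_span_le_card _).trans (by simp)

theorem incM_mulVec (P : PlaneGraph V) (y : allE P → ZMod 2) (f : P.faces)
    (Y : Sym2 V → ZMod 2) (hY : ∀ e : allE P, y e = Y e.1) :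
    (incM P).mulVec y f = ∑ e ∈ f.1, Y e := by
  simp only [Matrix.mulVec, dotProduct, incM, hY, ite_mul, one_mul, zero_mul]
  rw [Finset.sum_coe_sort (allE P) (fun e => if e ∈ f.1 then Y e else 0), ← Finset.sum_filter]
  refine Finset.sum_congr ?_ fun _ _ => rfl
  ext e
  simp only [mem_filter, mem_allE]
  exact ⟨fun h => h.2, fun h => ⟨P.face_edges _ f.2 e h, h⟩⟩

theorem ker_eq_range (P : PlaneGraph V) (hP : IsFullerene P) :
    LinearMap.range (cob P) = LinearMap.ker (incM P).mulVecLin := by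
  have hle : LinearMap.range (cob P) ≤ LinearMap.ker (incM P).mulVecLin := by
    rintro _ ⟨x, rfl⟩
    rw [LinearMap.mem_ker]
    ext f
    rw [Matrix.mulVecLin_apply, incM_mulVec P (cob P x) f (endSum x) (fun e => rfl)]
    exact face_sum P x f.2
  apply Submodule.eq_of_le_of_finrank_le hle
  have h1 := LinearMap.finrank_range_add_finrank_ker (cob P)
  have h2 := LinearMap.finrank_range_add_finrank_ker (incM P).mulVecLin
  have h3 := LinearMap.finrank_range_add_finrank_ker (incM P).transpose.mulVecLin
  have h4 : Module.finrank (ZMod 2) (LinearMap.range (incM P).transpose.mulVecLin) =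
    Module.finrank (ZMod 2) (LinearMap.range (incM P).mulVecLin) := (incM P).rank_transpose
  have h5 : Module.finrank (ZMod 2) (LinearMap.ker (cob P)) ≤ 1 := by
    apply finrank_le_one_of_const
    intro x hx i j
    have hadj : ∀ a b, P.graph.Adj a b → x a = x b := by
      intro a b hab
      have := congrFun (LinearMap.mem_ker.1 hx) ⟨s(a, b), mem_allE.2 hab⟩
      exact CharTwo.add_eq_zero.1 this
    obtain ⟨p⟩ := (graph_connected P hP).preconnected i j
    induction p with
    | nil => rfl
    | cons h p ih => rw [hadj _ _ h, ih]
  have h6 : Module.finrank (ZMod 2) (LinearMap.ker (incM P).transpose.mulVecLin) ≤ 1 := by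
    apply finrank_le_one_of_const
    intro y hy i j
    set Y : Finset (Sym2 V) → ZMod 2 := fun f => if h : f ∈ P.faces then y ⟨f, h⟩ else 0 with hY
    have hYy : ∀ f : P.faces, y f = Y f.1 := by intro f; simp [hY]
    rw [hYy, hYy]
    refine dual_const P hP Y ?_ _ i.2 _ j.2
    intro f hf g hg e hef heg
    by_cases hfg : f = g
    · rw [hfg]
    have heE := P.face_edges f hf e hef
    have h7 := congrFun (LinearMap.mem_ker.1 hy) ⟨e, mem_allE.2 heE⟩
    simp only [Matrix.mulVecLin_apply, Matrix.mulVec, dotProduct, incM, hYy, ite_mul, one_mul,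
      zero_mul, Matrix.transpose_apply, Pi.zero_apply] at h7
    rw [Finset.sum_coe_sort P.faces (fun f => if e ∈ f then Y f else 0), ← Finset.sum_filter] at h7
    have h8 : P.faces.filter (fun f => e ∈ f) = {f, g} := by
      symm
      apply eq_of_subset_of_card_le
      · intro k hk
        simp only [mem_insert, mem_singleton] at hk
        rcases hk with rfl | rfl <;> simp [*]
      · rw [P.edge_faces e heE, card_pair hfg]
    rw [h8, sum_pair hfg] at h7
    exact CharTwo.add_eq_zero.1 h7
  have h7 := two_card_allE P
  have h8 := P.euler
  simp only [Module.finrank_fintype_fun_eq_card, Fintype.card_coe] at h1 h2 h3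
  omega

/-- A set of edges meeting every face evenly is a cut. -/
theorem exists_cut (P : PlaneGraph V) (hP : IsFullerene P) (D : Finset (Sym2 V))
    (hD : ∀ f ∈ P.faces, Even (f ∩ D).card) :
    ∃ X : Finset V, ∀ a b, P.graph.Adj a b → (s(a, b) ∈ D ↔ ¬ (a ∈ X ↔ b ∈ X)) := by
  have hmem : (fun e : allE P => if e.1 ∈ D then (1 : ZMod 2) else 0) ∈
      LinearMap.ker (incM P).mulVecLin := by
    rw [LinearMap.mem_ker]
    ext f
    rw [Matrix.mulVecLin_apply, incM_mulVec P _ f (fun e => if e ∈ D then (1 : ZMod 2) else 0)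
      (fun e => rfl)]
    rw [← Finset.sum_filter, filter_mem_eq_inter]
    simp only [sum_const, nsmul_eq_mul, mul_one, Pi.zero_apply]
    exact (ZMod.natCast_eq_zero_iff_even).2 (hD f f.2)
  rw [← ker_eq_range P hP] at hmem
  obtain ⟨x, hx⟩ := hmem
  refine ⟨univ.filter fun v => x v = 1, fun a b hab => ?_⟩
  have h := congrFun hx ⟨s(a, b), mem_allE.2 hab⟩
  simp only [cob, LinearMap.coe_mk, AddHom.coe_mk, endSum_mk] at h
  simp only [mem_filter, mem_univ, true_and]
  have key : ∀ p q : ZMod 2, (p + q = 1 ↔ ¬ (p = 1 ↔ q = 1)) := by decide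
  rw [← key, h]
  by_cases hd : s(a, b) ∈ D <;> simp [hd]

theorem walk_side {G : SimpleGraph V} (X : Finset V) {u v : V} (p : G.Walk u v)
    (h : ∀ a b, s(a, b) ∈ p.edges → (a ∈ X ↔ b ∈ X)) : ∀ w ∈ p.support, (w ∈ X ↔ u ∈ X) := by
  induction p with
  | nil => intro w hw; simp at hw; rw [hw]
  | @cons a b c hab p ih =>
    intro w hw
    rw [SimpleGraph.Walk.support_cons, List.mem_cons] at hw
    rcases hw with rfl | hw
    · rfl
    · rw [ih (fun a b hh => h a b (by simp [hh])) w hw]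
      exact (h a b (by simp)).symm

/-- a face without crossing edges lies on one side -/
theorem face_side (P : PlaneGraph V) {f : Finset (Sym2 V)} (hf : f ∈ P.faces) (X : Finset V)
    (h : ∀ a b, s(a, b) ∈ f → (a ∈ X ↔ b ∈ X)) {u w : V} (hu : u ∈ edgeVerts f)
    (hw : w ∈ edgeVerts f) (huX : u ∈ X) : w ∈ X := by
  obtain ⟨t, c, hc, rfl⟩ := P.face_cycle f hf
  have hs : ∀ v ∈ edgeVerts c.edges.toFinset, v ∈ c.support := by
    intro v hv
    obtain ⟨e, he, hve⟩ := mem_edgeVerts.1 hv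
    induction e using Sym2.ind with
    | _ a b =>
      have he' : s(a, b) ∈ c.edges := by simpa using he
      rcases Sym2.mem_iff.1 hve with rfl | rfl
      · exact c.fst_mem_support_of_mem_edges he'
      · exact c.snd_mem_support_of_mem_edges he'
  have := walk_side X c (fun a b hh => h a b (by simpa using hh))
  rw [this w (hs w hw), ← this u (hs u hu)]
  exact huX

/-- every vertex of a connected induced subgraph lies in a set closed under adjacency -/
theorem closed_all (G : SimpleGraph V) (s : Set V) (hc : (SimpleGraph.induce sᶜ G).Connected)
    (T : Set V) (hT : ∀ a ∈ T, a ∉ s → ∀ b, b ∉ s → G.Adj a b → b ∈ T) {u w : V}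
    (hu : u ∉ s) (hw : w ∉ s) (huT : u ∈ T) : w ∈ T := by
  obtain ⟨p⟩ := hc.preconnected ⟨u, hu⟩ ⟨w, hw⟩
  have : ∀ (a b : (sᶜ : Set V)), (SimpleGraph.induce sᶜ G).Walk a b → a.1 ∈ T → b.1 ∈ T := by
    intro a b p
    induction p with
    | nil => exact id
    | @cons a b c hab p ih =>
      intro ha
      exact ih (hT a.1 ha a.2 b.1 b.2 hab)
  exact this _ _ p huT

theorem ring_core (P : PlaneGraph V) (hP : IsFullerene P)
    (R : ZMod 5 → Finset (Sym2 V)) (hR : IsPentRing P 5 R) (x y z : ZMod 5 → V) (X : Finset V)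
    (hV : ∀ i, edgeVerts (R i) = {x (i - 1), y (i - 1), x i, y i, z i})
    (hxX : ∀ i, x i ∈ X) (hyX : ∀ i, y i ∉ X)
    (hx : ∀ i j, x i ∈ edgeVerts (R j) → j = i ∨ j = i + 1)
    (hz : ∀ i j, z i ∈ edgeVerts (R j) → j = i)
    (hcut : ∀ a b, P.graph.Adj a b → (a ∈ X ↔ b ∈ X) ∨
      ∃ i, s(a, b) ∈ R i ∧ s(a, b) ∈ R (i + 1))
    (ha : (univ.filter fun i => z i ∈ X).card ≤ 2) :
    ∃ c ∈ P.faces, c.card = 5 ∧ (∀ i, c ≠ R i) ∧ edgeVerts c = univ.image x ∧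
      (∀ i, edgeVerts (R i) ∩ edgeVerts c = {x (i - 1), x i}) ∧ Function.Injective x := by
  obtain ⟨hinj, hface, hadj⟩ := hR
  have zx : ∀ i, x i ∈ edgeVerts (R i) := by intro i; rw [hV]; simp
  have zx' : ∀ i, x i ∈ edgeVerts (R (i + 1)) := by intro i; rw [hV]; simp
  have zz : ∀ i, z i ∈ edgeVerts (R i) := by intro i; rw [hV]; simp
  have hsucc : ∀ i : ZMod 5, i ≠ i + 1 := by decide
  have hxinj : Function.Injective x := by
    intro i j hij
    have h1 := hx i j (hij ▸ zx j)
    have h2 := hx i (j + 1) (hij ▸ zx' j)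
    have key : ∀ i j : ZMod 5, (j = i ∨ j = i + 1) → (j + 1 = i ∨ j + 1 = i + 1) → i = j := by
      decide
    exact key i j h1 h2
  have hzinj : Function.Injective z := by
    intro i j hij
    exact (hz i j (hij ▸ zz j)).symm
  have hxz : ∀ i j, x i ≠ z j := by
    intro i j hij
    have h1 := hz j i (hij ▸ zx i)
    have h2 := hz j (i + 1) (hij ▸ zx' i)
    exact hsucc i (h1.trans h2.symm)
  set A := univ.filter fun i => z i ∈ X with hA
  have hRX : ∀ i v, v ∈ edgeVerts (R i) → v ∈ X → v = x (i - 1) ∨ v = x i ∨ (v = z i ∧ i ∈ A) := by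
    intro i v hv hvX
    rw [hV] at hv
    simp only [mem_insert, mem_singleton] at hv
    rcases hv with rfl | rfl | rfl | rfl | rfl
    · simp
    · exact absurd hvX (hyX _)
    · simp
    · exact absurd hvX (hyX _)
    · right; right; exact ⟨rfl, by simp [hA, hvX]⟩
  -- every vertex of X is on the ring
  have hXR : ∀ v ∈ X, ∃ i, v ∈ edgeVerts (R i) := by
    intro w hw
    by_contra hcon
    set s : Finset V := A.image z with hs
    have hscard : (s : Set V).ncard ≤ 2 := by
      rw [Set.ncard_coe_finset]
      exact card_image_le.trans ha
    have hyn : y 0 ∉ (s : Set V) := by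
      intro h
      simp only [hs, coe_image, Set.mem_image, mem_coe] at h
      obtain ⟨i, hi, hh⟩ := h
      rw [hA, mem_filter] at hi
      exact hyX 0 (hh ▸ hi.2)
    have hwn : w ∉ (s : Set V) := by
      intro h
      simp only [hs, coe_image, Set.mem_image, mem_coe] at h
      obtain ⟨i, hi, hh⟩ := h
      exact hcon ⟨i, hh ▸ zz i⟩
    have := closed_all P.graph s (hP.threeConnected s hscard)
      {v | v ∈ X ∧ ¬ ∃ i, v ∈ edgeVerts (R i)} ?_ hwn hyn ⟨hw, hcon⟩
    · exact hyX 0 this.1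
    · rintro a ⟨haX, han⟩ _ b hbs hab
      have hbX : b ∈ X := by
        rcases hcut a b hab with h | ⟨i, h, _⟩
        · exact h.1 haX
        · exact (han ⟨i, mem_edgeVerts.2 ⟨_, h, by simp⟩⟩).elim
      refine ⟨hbX, ?_⟩
      rintro ⟨i, hi⟩
      have hxb : ∀ j, b ≠ x j := by
        rintro j rfl
        have h := (cover_edges P hP (hface j).1 (hface (j + 1)).1
          (fun h => hsucc j (hinj h)) (zx j) (zx' j)).1 s(a, x j) hab (by simp)
        rcases h with h | h
        · exact han ⟨_, mem_edgeVerts.2 ⟨_, h, by simp⟩⟩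
        · exact han ⟨_, mem_edgeVerts.2 ⟨_, h, by simp⟩⟩
      rcases hRX i b hi hbX with h | h | h
      · exact hxb _ h
      · exact hxb _ h
      · apply hbs
        simp only [hs, coe_image, Set.mem_image, mem_coe]
        exact ⟨i, h.2, h.1.symm⟩
  have hXeq : X = univ.image x ∪ A.image z := by
    ext v
    simp only [mem_union, mem_image, mem_univ, true_and]
    constructor
    · intro hv
      obtain ⟨i, hi⟩ := hXR v hv
      rcases hRX i v hi hv with h | h | h
      · exact Or.inl ⟨_, h.symm⟩
      · exact Or.inl ⟨_, h.symm⟩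
      · exact Or.inr ⟨i, h.2, h.1.symm⟩
    · rintro (⟨i, rfl⟩ | ⟨i, hi, rfl⟩)
      · exact hxX i
      · rw [hA, mem_filter] at hi
        exact hi.2
  have hXcard : X.card = 5 + A.card := by
    rw [hXeq, card_union_of_disjoint, card_image_of_injective _ hxinj,
      card_image_of_injective _ hzinj]
    · rfl
    · rw [disjoint_left]
      intro v h1 h2
      simp only [mem_image, mem_univ, true_and] at h1 h2
      obtain ⟨i, rfl⟩ := h1
      obtain ⟨j, _, h⟩ := h2
      exact hxz i j h.symm
  have hRcard : ∀ i, (edgeVerts (R i) ∩ X).card = 2 + if z i ∈ X then 1 else 0 := by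
    intro i
    have hpred : ∀ i : ZMod 5, i - 1 ≠ i := by decide
    have hne : x (i - 1) ≠ x i := fun h => hpred i (hxinj h)
    split_ifs with h
    · have : edgeVerts (R i) ∩ X = {x (i - 1), x i, z i} := by
        ext v
        simp only [mem_inter, mem_insert, mem_singleton]
        constructor
        · rintro ⟨h1, h2⟩
          have := hRX i v h1 h2
          tauto
        · rintro (rfl | rfl | rfl)
          · exact ⟨by rw [hV]; simp, hxX _⟩
          · exact ⟨by rw [hV]; simp, hxX _⟩
          · exact ⟨zz _, h⟩
      rw [this, card_eq_three.2 ⟨_, _, _, hne, hxz _ _, hxz _ _, rfl⟩]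
    · have : edgeVerts (R i) ∩ X = {x (i - 1), x i} := by
        ext v
        simp only [mem_inter, mem_insert, mem_singleton]
        constructor
        · rintro ⟨h1, h2⟩
          have := hRX i v h1 h2
          simp only [hA, mem_filter, h] at this
          tauto
        · rintro (rfl | rfl)
          · exact ⟨by rw [hV]; simp, hxX _⟩
          · exact ⟨by rw [hV]; simp, hxX _⟩
      rw [this, card_pair hne]
  have hRsum : ∑ i, (edgeVerts (R i) ∩ X).card = 10 + A.card := by
    rw [Finset.sum_congr rfl (fun i _ => hRcard i), sum_add_distrib, ← sum_filter]
    simp [hA]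
  have htot : ∑ f ∈ P.faces, (edgeVerts f ∩ X).card = 3 * X.card := by
    have h := Finset.sum_card_bipartiteAbove_eq_sum_card_bipartiteBelow
      (s := P.faces) (t := X) (fun (f : Finset (Sym2 V)) (v : V) => v ∈ edgeVerts f)
    simp only [bipartiteAbove, bipartiteBelow] at h
    rw [Finset.sum_congr rfl (g := fun f => (edgeVerts f ∩ X).card),
      Finset.sum_congr (s₂ := X) rfl (g := fun _ => 3)] at h
    · rw [h]; simp [mul_comm]
    · intro v _
      exact faces_at P hP v
    · intro f _
      congr 1
      ext v
      simp only [mem_filter, mem_inter]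
      tauto
  have hsubf : univ.image R ⊆ P.faces := by
    intro f hf
    simp only [mem_image, mem_univ, true_and] at hf
    obtain ⟨i, rfl⟩ := hf
    exact (hface i).1
  rw [← sum_sdiff hsubf, sum_image (fun a _ b _ h => hinj h), hRsum, hXcard] at htot
  set O := P.faces \ univ.image R with hO
  have hOside : ∀ f ∈ O, ∀ a b, s(a, b) ∈ f → (a ∈ X ↔ b ∈ X) := by
    intro f hf a b hab
    rw [hO, mem_sdiff] at hf
    rcases hcut a b (P.face_edges f hf.1 _ hab) with h | ⟨i, h1, h2⟩
    · exact h
    · exfalso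
      rcases three_faces P (hface i).1 (hface (i + 1)).1 hf.1 h1 h2 hab
        (fun h => hsucc i (hinj h)) with h | h
      · exact hf.2 (by rw [h]; simp)
      · exact hf.2 (by rw [h]; simp)
  have hOsub : ∀ f ∈ O, (edgeVerts f ∩ X).Nonempty → edgeVerts f ⊆ X := by
    intro f hf ⟨u, hu⟩ w hw
    rw [mem_inter] at hu
    have hf' := hf
    rw [hO, mem_sdiff] at hf'
    exact face_side P hf'.1 X (hOside f hf) hu.1 hw hu.2
  have hOcard : ∀ f ∈ O, (edgeVerts f ∩ X).Nonempty →
      (edgeVerts f ∩ X).card = 5 ∨ (edgeVerts f ∩ X).card = 6 := by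
    intro f hf hne
    rw [inter_eq_left.2 (hOsub f hf hne)]
    have hf' := hf
    rw [hO, mem_sdiff] at hf'
    rw [face_verts_card P hf'.1]
    exact hP.faceSize f hf'.1
  obtain ⟨c, hcO, hcne⟩ : ∃ c ∈ O, (edgeVerts c ∩ X).Nonempty := by
    by_contra hcon
    push Not at hcon
    rw [sum_eq_zero] at htot
    · omega
    · intro f hf
      rw [hcon f hf]; rfl
  have hrest : ∀ f ∈ O, f ≠ c → (edgeVerts f ∩ X).card = 0 := by
    intro f hf hfc
    by_contra hcon
    have hne : (edgeVerts f ∩ X).Nonempty := by rw [← card_pos]; omega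
    have h1 := hOcard f hf hne
    have h2 := hOcard c hcO hcne
    have h3 : ∑ g ∈ ({f, c} : Finset _), (edgeVerts g ∩ X).card ≤
        ∑ g ∈ O, (edgeVerts g ∩ X).card := by
      apply sum_le_sum_of_subset
      intro g hg
      simp only [mem_insert, mem_singleton] at hg
      rcases hg with rfl | rfl <;> assumption
    rw [sum_pair hfc] at h3
    omega
  rw [sum_eq_single_of_mem c hcO hrest] at htot
  have h5 := hOcard c hcO hcne
  have hA0 : A.card = 0 := by omega
  have hAe : A = ∅ := card_eq_zero.1 hA0
  have hcX : edgeVerts c ⊆ X := hOsub c hcO hcne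
  rw [inter_eq_left.2 hcX] at htot
  have hcO' := hcO
  rw [hO, mem_sdiff] at hcO'
  have hcEq : edgeVerts c = X := eq_of_subset_of_card_le hcX (by omega)
  refine ⟨c, hcO'.1, ?_, ?_, ?_, ?_, hxinj⟩
  · rw [← face_verts_card P hcO'.1]; omega
  · rintro i rfl
    exact hcO'.2 (by simp)
  · rw [hcEq, hXeq, hAe]; simp
  · intro i
    rw [hcEq]
    ext v
    simp only [mem_inter, mem_insert, mem_singleton]
    constructor
    · rintro ⟨h1, h2⟩
      have := hRX i v h1 h2
      simp only [hAe, notMem_empty] at this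
      tauto
    · rintro (rfl | rfl)
      · exact ⟨by rw [hV]; simp, hxX _⟩
      · exact ⟨by rw [hV]; simp, hxX _⟩

theorem ring_struct (P : PlaneGraph V) (hP : IsFullerene P)
    (R : ZMod 5 → Finset (Sym2 V)) (hR : IsPentRing P 5 R) :
    ∃ x : ZMod 5 → V, ∃ c ∈ P.faces, c.card = 5 ∧ (∀ i, c ≠ R i) ∧ edgeVerts c = univ.image x ∧
      (∀ i, edgeVerts (R i) ∩ edgeVerts c = {x (i - 1), x i}) ∧ Function.Injective x := by
  have hR' := hR
  obtain ⟨hinj, hface, hadj⟩ := hR'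
  have hsucc : ∀ i : ZMod 5, i ≠ i + 1 := by decide
  have hRne : ∀ i, R i ≠ R (i + 1) := fun i h => hsucc i (hinj h)
  have hcard5 : ∀ i, (edgeVerts (R i)).card = 5 := fun i => by
    rw [face_verts_card P (hface i).1, (hface i).2]
  have hnear : ∀ v i j, v ∈ edgeVerts (R i) → v ∈ edgeVerts (R j) →
      j = i ∨ j = i + 1 ∨ i = j + 1 := by
    intro v i j hi hj
    by_cases hij : i = j
    · exact Or.inl hij.symm
    · exact Or.inr ((hadj i j hij).1 ⟨v, mem_inter.2 ⟨hi, hj⟩⟩)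
  have harith : ∀ i j : ZMod 5, (j = i ∨ j = i + 1 ∨ i = j + 1) →
      (j = i + 1 ∨ j = i + 1 + 1 ∨ i + 1 = j + 1) → j = i ∨ j = i + 1 := by decide
  have hin : ∀ v i j, v ∈ edgeVerts (R i) → v ∈ edgeVerts (R (i + 1)) → v ∈ edgeVerts (R j) →
      j = i ∨ j = i + 1 := fun v i j h1 h2 h3 => harith i j (hnear v i j h1 h3) (hnear v _ j h2 h3)
  have hpos : ∀ i, 1 ≤ (R i ∩ R (i + 1)).card := by
    intro i
    have h := (hadj i (i + 1) (hsucc i)).2 (Or.inl rfl)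
    have h2 := (inter_matching P hP (hface i).1 (hface (i + 1)).1 (hRne i)).2
    have := card_pos.2 h
    omega
  have hsub1 : ∀ i : ZMod 5, i - 1 + 1 = i := by decide
  have hdisj : ∀ i, Disjoint (edgeVerts (R (i - 1)) ∩ edgeVerts (R i))
      (edgeVerts (R i) ∩ edgeVerts (R (i + 1))) := by
    intro i
    rw [disjoint_left]
    intro v h1 h2
    rw [mem_inter] at h1 h2
    have h := hin v i (i - 1) h2.1 h2.2 h1.1
    have key : ∀ i : ZMod 5, ¬ (i - 1 = i ∨ i - 1 = i + 1) := by decide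
    exact key i h
  have hcardle : ∀ i, (R (i - 1) ∩ R i).card + (R i ∩ R (i + 1)).card ≤ 2 := by
    intro i
    have h1 : (edgeVerts (R (i - 1)) ∩ edgeVerts (R i)) ∪
      (edgeVerts (R i) ∩ edgeVerts (R (i + 1))) ⊆ edgeVerts (R i) :=
      union_subset inter_subset_right inter_subset_left
    have h2 := card_le_card h1
    rw [card_union_of_disjoint (hdisj i), hcard5,
      (inter_matching P hP (hface i).1 (hface (i + 1)).1 (hRne i)).2] at h2
    have h3 := hRne (i - 1)
    rw [hsub1] at h3
    rw [(inter_matching P hP (hface (i - 1)).1 (hface i).1 h3).2] at h2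
    omega
  have hone : ∀ i, (R i ∩ R (i + 1)).card = 1 := by
    intro i
    have h1 := hcardle i
    have h2 := hpos i
    have h3 := hpos (i - 1)
    rw [hsub1] at h3
    omega
  choose e he using fun i => card_eq_one.1 (hone i)
  have heR : ∀ i, e i ∈ R i ∧ e i ∈ R (i + 1) := by
    intro i
    rw [← mem_inter, he i]; simp
  have heR' : ∀ i, e (i - 1) ∈ R i := by
    intro i
    have := (heR (i - 1)).2
    rwa [hsub1] at this
  have hVe : ∀ i v, (v ∈ edgeVerts (R i) ∧ v ∈ edgeVerts (R (i + 1))) ↔ v ∈ e i := by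
    intro i v
    rw [← mem_inter, (inter_matching P hP (hface i).1 (hface (i + 1)).1 (hRne i)).1, he i,
      mem_edgeVerts]
    simp
  have heinj : ∀ i, e (i - 1) ≠ e i := by
    intro i h
    obtain ⟨v, hv⟩ : ∃ v, v ∈ e i := by
      induction e i using Sym2.ind with
      | _ a b => exact ⟨a, by simp⟩
    have h1 := (hVe i v).2 hv
    have h2 := (hVe (i - 1) v).2 (h ▸ hv)
    rw [hsub1] at h2
    exact disjoint_left.1 (hdisj i) (mem_inter.2 h2) (mem_inter.2 h1)
  set D := univ.image e with hD
  have heven : ∀ f ∈ P.faces, Even (f ∩ D).card := by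
    intro f hf
    by_cases hfR : ∃ i, f = R i
    · obtain ⟨i, rfl⟩ := hfR
      have : R i ∩ D = {e (i - 1), e i} := by
        ext k
        simp only [mem_inter, hD, mem_image, mem_univ, true_and, mem_insert, mem_singleton]
        constructor
        · rintro ⟨hk, j, rfl⟩
          rcases three_faces P (hface j).1 (hface (j + 1)).1 hf (heR j).1 (heR j).2 hk
            (hRne j) with h | h
          · right; rw [hinj h]
          · left
            rw [hinj h]
            congr 1
            ring
        · rintro (rfl | rfl)
          · exact ⟨heR' i, _, rfl⟩
          · exact ⟨(heR i).1, _, rfl⟩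
      rw [this, card_pair (heinj i)]
      exact even_two
    · have : f ∩ D = ∅ := by
        rw [eq_empty_iff_forall_notMem]
        intro k hk
        simp only [mem_inter, hD, mem_image, mem_univ, true_and] at hk
        obtain ⟨hk, j, rfl⟩ := hk
        rcases three_faces P (hface j).1 (hface (j + 1)).1 hf (heR j).1 (heR j).2 hk
            (hRne j) with h | h
        · exact hfR ⟨_, h⟩
        · exact hfR ⟨_, h⟩
      rw [this]; simp
  obtain ⟨X, hX⟩ := exists_cut P hP D heven
  have hxy : ∀ i, ∃ x y, e i = s(x, y) ∧ x ∈ X ∧ y ∉ X := by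
    intro i
    have hE := P.face_edges _ (hface i).1 _ (heR i).1
    have hiD : e i ∈ D := by simp [hD]
    generalize e i = k at hE hiD
    induction k using Sym2.ind with
    | _ a b =>
      have h := (hX a b hE).1 hiD
      by_cases ha : a ∈ X
      · exact ⟨a, b, rfl, ha, fun hb => h (by simp [ha, hb])⟩
      · refine ⟨b, a, Sym2.eq_swap, ?_, ha⟩
        by_contra hb
        exact h (by simp [ha, hb])
  choose x y hexy hxX hyX using hxy
  have hVxy : ∀ i, edgeVerts (R i) ∩ edgeVerts (R (i + 1)) = {x i, y i} := by
    intro i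
    ext v
    rw [mem_inter, hVe, hexy]
    simp
  have hzex : ∀ i, ∃ z, edgeVerts (R i) = {x (i - 1), y (i - 1), x i, y i, z} ∧
      z ∉ edgeVerts (R (i - 1)) ∧ z ∉ edgeVerts (R (i + 1)) := by
    intro i
    have h1 : (edgeVerts (R (i - 1)) ∩ edgeVerts (R i)) ∪
      (edgeVerts (R i) ∩ edgeVerts (R (i + 1))) ⊆ edgeVerts (R i) :=
      union_subset inter_subset_right inter_subset_left
    have hc1 := (inter_matching P hP (hface i).1 (hface (i + 1)).1 (hRne i)).2
    have h3 := hRne (i - 1)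
    rw [hsub1] at h3
    have hc2 := (inter_matching P hP (hface (i - 1)).1 (hface i).1 h3).2
    have ho := hone (i - 1)
    rw [hsub1] at ho
    rw [hone] at hc1
    rw [ho] at hc2
    have h4 : (edgeVerts (R i) \ ((edgeVerts (R (i - 1)) ∩ edgeVerts (R i)) ∪
      (edgeVerts (R i) ∩ edgeVerts (R (i + 1))))).card = 1 := by
      rw [card_sdiff_of_subset h1, card_union_of_disjoint (hdisj i), hcard5, hc1, hc2]
    obtain ⟨z, hz⟩ := card_eq_one.1 h4
    have hzm : z ∈ edgeVerts (R i) \ ((edgeVerts (R (i - 1)) ∩ edgeVerts (R i)) ∪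
      (edgeVerts (R i) ∩ edgeVerts (R (i + 1)))) := by rw [hz]; simp
    refine ⟨z, ?_, ?_, ?_⟩
    · have h5 := hVxy (i - 1)
      rw [hsub1] at h5
      rw [← union_sdiff_of_subset h1, hz, h5, hVxy i]
      ext v
      simp only [mem_union, mem_insert, mem_singleton]
      tauto
    · simp only [mem_sdiff, mem_union, mem_inter] at hzm
      tauto
    · simp only [mem_sdiff, mem_union, mem_inter] at hzm
      tauto
  choose z hV hz1 hz2 using hzex
  have hz : ∀ i j, z i ∈ edgeVerts (R j) → j = i := by
    intro i j hj
    rcases hnear (z i) i j (by rw [hV]; simp) hj with h | h | h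
    · exact h
    · rw [h] at hj; exact absurd hj (hz2 i)
    · have : j = i - 1 := by rw [h]; ring
      rw [this] at hj; exact absurd hj (hz1 i)
  have hxy2 : ∀ i j, (x i ∈ edgeVerts (R j) → j = i ∨ j = i + 1) ∧
      (y i ∈ edgeVerts (R j) → j = i ∨ j = i + 1) := by
    intro i j
    have h1 := (hVe i (x i)).2 (by rw [hexy]; simp)
    have h2 := (hVe i (y i)).2 (by rw [hexy]; simp)
    exact ⟨fun h => hin _ i j h1.1 h1.2 h, fun h => hin _ i j h2.1 h2.2 h⟩
  have hcut : ∀ a b, P.graph.Adj a b → (a ∈ X ↔ b ∈ X) ∨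
      ∃ i, s(a, b) ∈ R i ∧ s(a, b) ∈ R (i + 1) := by
    intro a b hab
    by_cases h : s(a, b) ∈ D
    · right
      simp only [hD, mem_image, mem_univ, true_and] at h
      obtain ⟨i, hi⟩ := h
      exact ⟨i, hi ▸ heR i⟩
    · left
      by_contra hc
      exact h ((hX a b hab).2 hc)
  have hsplit := card_filter_add_card_filter_not (s := (univ : Finset (ZMod 5)))
    (fun i => z i ∈ X)
  have h5 : (univ : Finset (ZMod 5)).card = 5 := rfl
  by_cases ha : (univ.filter fun i => z i ∈ X).card ≤ 2
  · exact ⟨x, ring_core P hP R hR x y z X hV hxX hyX (fun i j => (hxy2 i j).1) hz hcut ha⟩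
  · refine ⟨y, ring_core P hP R hR y x z Xᶜ ?_ ?_ ?_ (fun i j => (hxy2 i j).2) hz ?_ ?_⟩
    · intro i
      rw [hV]
      ext v
      simp only [mem_insert, mem_singleton]
      tauto
    · intro i; simpa using hyX i
    · intro i; simpa using hxX i
    · intro a b hab
      rcases hcut a b hab with h | h
      · left; simp only [mem_compl]; tauto
      · exact Or.inr h
    · simp only [mem_compl]
      omega

/-- every pentagon of `G` has a vertex in `U` whose matching edge leaves the pentagon -/
theorem exists_exit (P : PlaneGraph V) (hP : IsFullerene P) (H : Finset (Finset (Sym2 V)))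
    (h1 : ∀ f ∈ H, f ∈ P.faces ∧ f.card = 6)
    (h2 : ∀ f ∈ H, ∀ g ∈ H, f ≠ g → Disjoint (edgeVerts f) (edgeVerts g))
    (M : Finset (Sym2 V)) (hM : IsMatching M)
    (hMH : ∀ e ∈ M, ∀ v : V, v ∈ e → v ∉ facesVerts H) (p : Finset (Sym2 V)) (hp : p ∈ P.faces)
    (hp5 : p.card = 5) :
    ∃ v ∈ edgeVerts p, v ∉ facesVerts H ∧ ∀ e ∈ M, v ∈ e → e ∉ p := by
  have hfv : ∀ v, v ∈ facesVerts H ↔ ∃ h ∈ H, v ∈ edgeVerts h := by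
    intro v
    simp only [facesVerts, mem_edgeVerts, mem_sup, id]
    constructor
    · rintro ⟨e, ⟨h, hh, he⟩, hv⟩
      exact ⟨h, hh, e, he, hv⟩
    · rintro ⟨h, hh, e, he, hv⟩
      exact ⟨e, ⟨h, hh, he⟩, hv⟩
  have hne : ∀ h ∈ H, p ≠ h := by
    rintro h hh rfl
    have := (h1 _ hh).2
    omega
  set N : Finset (Sym2 V) := p.filter fun e => e ∈ M ∨ ∃ h ∈ H, e ∈ h with hN
  have hNm : IsMatching N := by
    constructor
    · intro e he
      exact face_not_diag P hp (mem_filter.1 he).1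
    · intro e he e' he' hee v hv hv'
      simp only [hN, mem_filter] at he he'
      obtain ⟨hep, he⟩ := he
      obtain ⟨hep', he'⟩ := he'
      rcases he with he | ⟨h, hh, he⟩ <;> rcases he' with he' | ⟨h', hh', he'⟩
      · exact hM.2 e he e' he' hee v hv hv'
      · exact hMH e he v hv ((hfv v).2 ⟨h', hh', mem_edgeVerts.2 ⟨e', he', hv'⟩⟩)
      · exact hMH e' he' v hv' ((hfv v).2 ⟨h, hh, mem_edgeVerts.2 ⟨e, he, hv⟩⟩)
      · by_cases hhh : h = h'
        · subst hhh
          exact hee (common_le P hP hp (h1 h hh).1 (hne h hh) hep he hep' he' hv hv')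
        · exact disjoint_left.1 (h2 h hh h' hh' hhh) (mem_edgeVerts.2 ⟨e, he, hv⟩)
            (mem_edgeVerts.2 ⟨e', he', hv'⟩)
  have hcard := matching_card N hNm
  have hpc := face_verts_card P hp
  have hnsub : ¬ edgeVerts p ⊆ edgeVerts N := by
    intro hsub
    have hsub' : edgeVerts N ⊆ edgeVerts p := by
      intro v hv
      obtain ⟨e, he, hv⟩ := mem_edgeVerts.1 hv
      exact mem_edgeVerts.2 ⟨e, (mem_filter.1 he).1, hv⟩
    rw [hsub.antisymm hsub'] at hpc
    omega
  obtain ⟨v, hvp, hvN⟩ := not_subset.1 hnsub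
  refine ⟨v, hvp, ?_, ?_⟩
  · intro hv
    obtain ⟨h, hh, hvh⟩ := (hfv v).1 hv
    obtain ⟨e, h3, h4, h5⟩ := (cover_edges P hP hp (h1 h hh).1 (hne h hh) hvp hvh).2
    exact hvN (mem_edgeVerts.2 ⟨e, mem_filter.2 ⟨h3, Or.inr ⟨h, hh, h4⟩⟩, h5⟩)
  · intro e he hve hep
    exact hvN (mem_edgeVerts.2 ⟨e, mem_filter.2 ⟨hep, Or.inl he⟩, hve⟩)

theorem combi (A B C : ZMod 5 → Prop) (h1 : ∀ i, A i ∨ B i ∨ C i)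
    (h2 : ∀ i j, A i → A j → i = j) (h3 : ∀ i, B i → C (i + 1)) (h4 : ∀ i, C i → B (i - 1))
    (h5 : ∀ i, C i → ¬ B (i + 1))  (hBC : ∀ i, B i → ¬ C i) : False := by
  have s1 : ∀ i, C i → A (i + 1) := by
    intro i hi
    rcases h1 (i + 1) with h | h | h
    · exact h
    · exact absurd h (h5 i hi)
    · have := h4 _ h
      rw [add_sub_cancel_right] at this
      exact absurd hi (hBC i this)
  have s2 : ∀ i, B i → A (i + 2) := by
    intro i hi
    have := s1 _ (h3 i hi)
    rwa [add_assoc, one_add_one_eq_two] at this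
  have s3 : ∀ i, ∃ j, A j ∧ (j = i ∨ j = i + 2 ∨ j = i + 1) := by
    intro i
    rcases h1 i with h | h | h
    · exact ⟨i, h, by simp⟩
    · exact ⟨_, s2 i h, by simp⟩
    · exact ⟨_, s1 i h, by simp⟩
  obtain ⟨j, hj, _⟩ := s3 0
  obtain ⟨k, hk, hk'⟩ := s3 (j + 1)
  have hjk := h2 j k hj hk
  have key : ∀ j : ZMod 5, ¬ (j = j + 1 ∨ j = j + 1 + 2 ∨ j = j + 1 + 1) := by decide
  exact key j (by rw [← hjk] at hk'; exact hk')

end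

/-- Observation 2. Let `G` be a subgraph of a fullerene graph. If
`R_5 ⊆ G`, then `G` is not extremal. -/
theorem statement_6 (P : PlaneGraph V) (hP : IsFullerene P) (E : Finset (Sym2 V))
    (hE : ∀ e ∈ E, e ∈ P.graph.edgeSet)
    (R : ZMod 5 → Finset (Sym2 V)) (hR : IsPentRing P 5 R) (hsub : ∀ i, R i ⊆ E) :
    ¬IsExtremalSub P E := by
  rintro ⟨H, ⟨⟨hH1, hH2, M, hME, hM, hMH, hMcov⟩, -⟩, hcard⟩
  have hH1' : ∀ f ∈ H, f ∈ P.faces ∧ f.card = 6 := fun f hf => ⟨(hH1 f hf).1, (hH1 f hf).2.1⟩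
  have hdeg : ∀ v, (∀ e ∈ P.graph.edgeSet, v ∈ e → e ∈ E) → deg E v = 3 := by
    intro v hv
    rw [deg, ← deg_allE P hP v]
    congr 1
    ext e
    simp only [Finset.mem_filter, mem_allE]
    exact ⟨fun h => ⟨hE e h.1, h.2⟩, fun h => ⟨hv e h.1 h.2, h.2⟩⟩
  have hsubV : ∀ p, p ⊆ E → edgeVerts p ⊆ edgeVerts E := by
    intro p hp v hv
    obtain ⟨e, he, hve⟩ := mem_edgeVerts.1 hv
    exact mem_edgeVerts.2 ⟨e, hp he, hve⟩
  -- the exit relation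
  let Q : V → Finset (Sym2 V) → Prop := fun v p =>
    p ∈ pentFaces P E ∧ v ∈ edgeVerts p ∧ v ∉ facesVerts H ∧ ∀ e ∈ M, v ∈ e → e ∉ p
  have hpent : ∀ p, p ∈ pentFaces P E ↔ p ∈ P.faces ∧ p.card = 5 ∧ p ⊆ E := by
    intro p; simp [pentFaces]
  have hex : ∀ p ∈ pentFaces P E, ∃ v, Q v p := by
    intro p hp
    have hp' := (hpent p).1 hp
    obtain ⟨v, h1, h2, h3⟩ := exists_exit P hP H hH1' hH2 M hM hMH p hp'.1 hp'.2.1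
    exact ⟨v, hp, h1, h2, h3⟩
  have huniq : ∀ v p q, Q v p → Q v q → p = q := by
    rintro v p q ⟨hp, h1, h2, h3⟩ ⟨hq, h4, -, h5⟩
    by_contra hpq
    rw [hpent] at hp hq
    have hc := (cover_edges P hP hp.1 hq.1 hpq h1 h4).1
    obtain ⟨e, he, hve⟩ := hMcov v (hsubV p hp.2.2 h1) (hdeg v fun e he hve => by
      rcases hc e he hve with h | h
      · exact hp.2.2 h
      · exact hq.2.2 h) h2
    rcases hc e (hE e (hME he)) hve with h | h
    · exact h3 e he hve h
    · exact h5 e he hve h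
  haveI : Nonempty V := (graph_connected P hP).nonempty
  choose! g hg using hex
  have himg : (pentFaces P E).image g ⊆ Uset E H := by
    intro v hv
    obtain ⟨p, hp, rfl⟩ := Finset.mem_image.1 hv
    obtain ⟨h0, h1, h2, -⟩ := hg p hp
    exact Finset.mem_sdiff.2 ⟨hsubV p ((hpent p).1 h0).2.2 h1, h2⟩
  have hginj : Set.InjOn g (pentFaces P E) := by
    intro p hp q hq hpq
    exact huniq (g p) p q (hg p hp) (hpq ▸ hg q hq)
  have himgeq : (pentFaces P E).image g = Uset E H :=
    Finset.eq_of_subset_of_card_le himg (by rw [Finset.card_image_of_injOn hginj, hcard])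
  have hQg : ∀ v p, Q v p → v = g p := by
    intro v p h
    have hv : v ∈ Uset E H :=
      Finset.mem_sdiff.2 ⟨hsubV p ((hpent p).1 h.1).2.2 h.2.1, h.2.2.1⟩
    rw [← himgeq] at hv
    obtain ⟨q, hq, rfl⟩ := Finset.mem_image.1 hv
    rw [huniq _ p q h (hg q hq)]
  have hQinj : ∀ v w p, Q v p → Q w p → v = w := fun v w p h1 h2 =>
    (hQg v p h1).trans (hQg w p h2).symm
  -- the ring
  obtain ⟨x, c, hc, hc5, hcR, hcV, hcI, hxinj⟩ := ring_struct P hP R hR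
  obtain ⟨hinj, hface, -⟩ := hR
  have hsucc : ∀ i : ZMod 5, i ≠ i + 1 := by decide
  have hRne : ∀ i, R i ≠ R (i + 1) := fun i h => hsucc i (hinj h)
  have hxc : ∀ i, x i ∈ edgeVerts c := by intro i; rw [hcV]; simp
  have hxR : ∀ i, x i ∈ edgeVerts (R i) := by
    intro i
    have : x i ∈ edgeVerts (R i) ∩ edgeVerts c := by rw [hcI]; simp
    exact (Finset.mem_inter.1 this).1
  have hxR' : ∀ i, x i ∈ edgeVerts (R (i + 1)) := by
    intro i
    have : x i ∈ edgeVerts (R (i + 1)) ∩ edgeVerts c := by rw [hcI]; simp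
    exact (Finset.mem_inter.1 this).1
  have hxE : ∀ i, ∀ e ∈ P.graph.edgeSet, x i ∈ e → e ∈ E := by
    intro i e he hxe
    rcases (cover_edges P hP (hface i).1 (hface (i + 1)).1 (hRne i) (hxR i) (hxR' i)).1 e he hxe
      with h | h
    · exact hsub _ h
    · exact hsub _ h
  have hcE : c ⊆ E := by
    intro e he
    obtain ⟨v, hv⟩ : ∃ v, v ∈ e := by
      induction e using Sym2.ind with
      | _ a b => exact ⟨a, by simp⟩
    have hvc : v ∈ edgeVerts c := mem_edgeVerts.2 ⟨e, he, hv⟩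
    rw [hcV] at hvc
    obtain ⟨i, -, rfl⟩ := Finset.mem_image.1 hvc
    exact hxE i e (P.face_edges c hc e he) hv
  have hcP : c ∈ pentFaces P E := (hpent c).2 ⟨hc, hc5, hcE⟩
  have hRP : ∀ i, R i ∈ pentFaces P E := fun i => (hpent _).2 ⟨(hface i).1, (hface i).2, hsub i⟩
  have hfaces : ∀ i, ∀ f ∈ P.faces, x i ∈ edgeVerts f → f = c ∨ f = R i ∨ f = R (i + 1) := by
    intro i f hf hx
    by_contra hcon
    push Not at hcon
    have h3 := faces_at P hP (x i)
    have h4 : ({f, c, R i, R (i + 1)} : Finset _) ⊆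
        P.faces.filter fun f => x i ∈ edgeVerts f := by
      intro k hk
      simp only [Finset.mem_insert, Finset.mem_singleton] at hk
      rw [Finset.mem_filter]
      rcases hk with rfl | rfl | rfl | rfl
      · exact ⟨hf, hx⟩
      · exact ⟨hc, hxc i⟩
      · exact ⟨(hface _).1, hxR i⟩
      · exact ⟨(hface _).1, hxR' i⟩
    have h5 := Finset.card_le_card h4
    rw [Finset.card_insert_of_notMem (by simp [hcon.1, hcon.2.1, hcon.2.2]),
      Finset.card_eq_three.2 ⟨c, R i, R (i + 1), hcR _, hcR _, hRne i, rfl⟩] at h5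
    omega
  have hxH : ∀ i, x i ∉ facesVerts H := by
    intro i hi
    simp only [facesVerts, mem_edgeVerts, Finset.mem_sup, id] at hi
    obtain ⟨e, ⟨h, hh, he⟩, hv⟩ := hi
    have h6 := (hH1' h hh).2
    rcases hfaces i h (hH1' h hh).1 (mem_edgeVerts.2 ⟨e, he, hv⟩) with rfl | rfl | rfl
    · omega
    · have := (hface i).2; omega
    · have := (hface (i + 1)).2; omega
  have hmatch : ∀ i, ∃ e ∈ M, x i ∈ e := fun i =>
    hMcov (x i) (hsubV c hcE (hxc i)) (hdeg _ (hxE i)) (hxH i)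
  choose m hmM hxm using hmatch
  have hmuniq : ∀ i, ∀ e ∈ M, x i ∈ e → e = m i := by
    intro i e he hx
    by_contra hne
    exact hM.2 e he (m i) (hmM i) hne (x i) hx (hxm i)
  have hmE : ∀ i, m i ∈ P.graph.edgeSet := fun i => hE _ (hME (hmM i))
  have hQiff : ∀ i p, p ∈ pentFaces P E → x i ∈ edgeVerts p → (Q (x i) p ↔ m i ∉ p) := by
    intro i p hp hx
    constructor
    · intro h
      exact h.2.2.2 _ (hmM i) (hxm i)
    · intro h
      refine ⟨hp, hx, hxH i, fun e he hxe => ?_⟩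
      rw [hmuniq i e he hxe]
      exact h
  have hnot : ∀ i f f', f ∈ P.faces → f' ∈ P.faces → f ≠ f' → x i ∈ edgeVerts f →
      x i ∈ edgeVerts f' → m i ∉ f → m i ∈ f' := by
    intro i f f' hf hf' hne h1 h2 h3
    exact ((cover_edges P hP hf hf' hne h1 h2).1 (m i) (hmE i) (hxm i)).resolve_left h3
  -- an edge at `x i` in `c` and a ring pentagon goes to the neighbouring `x`
  have hother : ∀ i j k, m i ∈ c → m i ∈ R k → ({x (k - 1), x k} : Finset V) = {x i, x j} →
      m j = m i := by
    intro i j k h1 h2 h3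
    obtain ⟨w, hw⟩ := Sym2.mem_iff_exists.1 (hxm i)
    have hwm : w ∈ m i := by rw [hw]; simp
    have hwx : w ≠ x i := by
      intro h
      have := hM.1 _ (hmM i)
      rw [hw, h] at this
      exact this (by simp)
    have hwI : w ∈ edgeVerts (R k) ∩ edgeVerts c :=
      Finset.mem_inter.2 ⟨mem_edgeVerts.2 ⟨_, h2, hwm⟩, mem_edgeVerts.2 ⟨_, h1, hwm⟩⟩
    rw [hcI, h3] at hwI
    simp only [Finset.mem_insert, Finset.mem_singleton, hwx, false_or] at hwI
    exact (hmuniq j (m i) (hmM i) (hwI ▸ hwm)).symm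
  have hadd : ∀ i : ZMod 5, i + 1 - 1 = i := fun i => add_sub_cancel_right i 1
  have hsubadd : ∀ i : ZMod 5, i - 1 + 1 = i := fun i => sub_add_cancel i 1
  refine combi (fun i => Q (x i) c) (fun i => Q (x i) (R i)) (fun i => Q (x i) (R (i + 1)))
    ?_ ?_ ?_ ?_ ?_ ?_
  · intro i
    by_contra hcon
    push Not at hcon
    obtain ⟨n1, n2, n3⟩ := hcon
    rw [hQiff i c hcP (hxc i), not_not] at n1
    rw [hQiff i _ (hRP _) (hxR i), not_not] at n2
    rw [hQiff i _ (hRP _) (hxR' i), not_not] at n3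
    rcases three_faces P (hface i).1 (hface (i + 1)).1 hc n2 n3 n1 (hRne i) with h | h
    · exact hcR _ h
    · exact hcR _ h
  · intro i j hi hj
    exact hxinj (hQinj _ _ c hi hj)
  · intro i hi
    have hn := (hQiff i _ (hRP i) (hxR i)).1 hi
    have h1 := hnot i _ _ (hface i).1 hc (hcR i).symm (hxR i) (hxc i) hn
    have h2 := hnot i _ _ (hface i).1 (hface (i + 1)).1 (hRne i) (hxR i) (hxR' i) hn
    have h3 := hother i (i + 1) (i + 1) h1 h2 (by rw [hadd])
    rw [hQiff (i + 1) _ (hRP _) (hxR' _), h3]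
    intro h4
    rcases three_faces P hc (hface (i + 1)).1 (hface (i + 1 + 1)).1 h1 h2 h4 (hcR _) with h | h
    · exact hcR _ h.symm
    · exact hRne _ h.symm
  · intro i hi
    have hn := (hQiff i _ (hRP _) (hxR' i)).1 hi
    have h1 := hnot i _ _ (hface _).1 hc (hcR _).symm (hxR' i) (hxc i) hn
    have h2 := hnot i _ _ (hface (i + 1)).1 (hface i).1 (hRne i).symm (hxR' i) (hxR i) hn
    have h3 := hother i (i - 1) i h1 h2 (Finset.pair_comm _ _)
    rw [hQiff (i - 1) _ (hRP _) (hxR _), h3]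
    intro h4
    rcases three_faces P hc (hface i).1 (hface (i - 1)).1 h1 h2 h4 (hcR _) with h | h
    · exact hcR _ h.symm
    · have := hRne (i - 1)
      rw [hsubadd] at this
      exact this h
  · intro i h1 h2
    exact hsucc i (hxinj (hQinj _ _ _ h1 h2))
  · intro i h1 h2
    exact hRne i (huniq _ _ _ h1 h2)

end FG
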